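/- arXiv:2503.04583 — 2 statements merged into one kernel-verified Lean document; each statement's English description precedes it below -/
import Mathlib

section
/- Let G be a network (a finite, strongly connected directed multigraph without self-loops) and suppose there exist a vertex v, a spanning in-tree T_in of G rooted at v, and a spanning out-tree T_out of G rooted at v with T_in ∩ T_out = ∅. Then G admits a deadlock-free routing scheme; in particular the routing scheme that sends a message from u to w along the unique T_in-path from u to v followed by the unique T_out-path from v to w (omitting the corresponding half when u = v or w = v) has an acyclic dependency relation. -/
/-- `p` is a directed path from `u` to `w` in the directed multigraph given by
`src, tgt : E → V`: a nonempty list of edges where the target of each edge equals the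
source of the next, starting at `u` and ending at `w`. -/
def IsPathFrom {V E : Type*} (src tgt : E → V) (u w : V) (p : List E) : Prop :=
  p ≠ [] ∧ p.Chain' (fun e₁ e₂ => tgt e₁ = src e₂) ∧
    p.head?.map src = some u ∧ p.getLast?.map tgt = some w

/-- `w` is reachable from `u` by a directed path using only edges from `A`. -/
def ReachableVia {V E : Type*} (src tgt : E → V) (A : Set E) (u w : V) : Prop :=
  ∃ p : List E, (∀ e ∈ p, e ∈ A) ∧ IsPathFrom src tgt u w p

/-- The graph is strongly connected: every vertex reaches every other vertex. -/
def StronglyConnected {V E : Type*} (src tgt : E → V) : Prop :=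
  ∀ u w : V, u ≠ w → ReachableVia src tgt Set.univ u w

/-- `route` is a routing scheme: it assigns to every ordered pair of distinct vertices
a directed path between them. -/
def IsRouting {V E : Type*} (src tgt : E → V) (route : ∀ u w : V, u ≠ w → List E) : Prop :=
  ∀ (u w : V) (h : u ≠ w), IsPathFrom src tgt u w (route u w h)

/-- The dependency relation of a routing scheme: `Dep route e₁ e₂` iff `e₂` immediately
follows `e₁` on some routing path. -/
def Dep {V E : Type*} (route : ∀ u w : V, u ≠ w → List E) (e₁ e₂ : E) : Prop :=
  ∃ (u w : V) (h : u ≠ w), [e₁, e₂] <:+: route u w h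

/-- A routing scheme is deadlock-free iff its dependency relation is acyclic. -/
def DeadlockFree {V E : Type*} (route : ∀ u w : V, u ≠ w → List E) : Prop :=
  Irreflexive (Relation.TransGen (Dep route))

/-- `T` is a spanning in-tree rooted at `v`: it has exactly `|V| - 1` edges and every
vertex other than `v` has a directed path to `v` using only edges of `T`. -/
def IsInTree {V E : Type*} [Fintype V] (src tgt : E → V) (v : V) (T : Finset E) : Prop :=
  T.card = Fintype.card V - 1 ∧ ∀ u : V, u ≠ v → ReachableVia src tgt ↑T u v

/-- `T` is a spanning out-tree rooted at `v`: it has exactly `|V| - 1` edges and every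
vertex other than `v` is reachable from `v` by a directed path using only edges of `T`. -/
def IsOutTree {V E : Type*} [Fintype V] (src tgt : E → V) (v : V) (T : Finset E) : Prop :=
  T.card = Fintype.card V - 1 ∧ ∀ w : V, w ≠ v → ReachableVia src tgt ↑T v w

/-- A linear order on `E` respects a routing scheme if `e₁ < e₂` whenever `e₂`
immediately follows `e₁` on some routing path. -/
def RespectsRouting {V E : Type*} (route : ∀ u w : V, u ≠ w → List E)
    (ord : LinearOrder E) : Prop :=
  ∀ e₁ e₂ : E, Dep route e₁ e₂ → ord.lt e₁ e₂

/-- The set of the `s` smallest edges of a linear order on `E`. -/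
def smallestEdges {E : Type*} (ord : LinearOrder E) (s : ℕ) : Set E :=
  {e | {e' | ord.le e' e}.ncard ≤ s}

/-- `v` is a global attractor of the subgraph with edge set `A`: it is reachable from
every other vertex by a directed path using only edges of `A`. -/
def IsGlobalAttractor {V E : Type*} (src tgt : E → V) (A : Set E) (v : V) : Prop :=
  ∀ u : V, u ≠ v → ReachableVia src tgt A u v

/-- The attraction number of a linear order on `E`: the least `s` such that the subgraph
consisting of the `s` smallest edges has a global attractor. -/
noncomputable def attractionNumber {V E : Type*} (src tgt : E → V) (ord : LinearOrder E) : ℕ :=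
  sInf {s | ∃ v : V, IsGlobalAttractor src tgt (smallestEdges ord s) v}

/-- A path with at least two edges has a tail that is again a path. -/
theorem IsPathFrom.tail {V E : Type*} {src tgt : E → V} {u w : V} {e : E} {p : List E}
    (h : IsPathFrom src tgt u w (e :: p)) (hp : p ≠ []) : IsPathFrom src tgt (tgt e) w p := by
  obtain ⟨f, q, rfl⟩ := List.exists_cons_of_ne_nil hp
  obtain ⟨-, hc, -, hl⟩ := h
  have hc := List.isChain_cons_cons.1 hc
  refine ⟨hp, hc.2, ?_, ?_⟩
  · simp [hc.1]
  · simpa [List.getLast?_cons_cons] using hl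

theorem IsPathFrom.append {V E : Type*} {src tgt : E → V} {u v w : V} {p q : List E}
    (hp : IsPathFrom src tgt u v p) (hq : IsPathFrom src tgt v w q) :
    IsPathFrom src tgt u w (p ++ q) := by
  obtain ⟨hp₀, hpc, hph, hpl⟩ := hp
  obtain ⟨hq₀, hqc, hqh, hql⟩ := hq
  refine ⟨by simp [hp₀], List.isChain_append.2 ⟨hpc, hqc, ?_⟩, ?_, ?_⟩
  · intro x hx y hy
    rw [Option.mem_def] at hx hy
    rw [hx] at hpl
    rw [hy] at hqh
    simp only [Option.map_some, Option.some.injEq] at hpl hqh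
    rw [hpl, hqh]
  · rwa [List.head?_append_of_ne_nil _ hp₀]
  · rwa [List.getLast?_append_of_ne_nil _ hq₀]

/-- Reversing a path gives a path in the opposite graph. -/
theorem IsPathFrom.reverse {V E : Type*} {src tgt : E → V} {u w : V} {p : List E}
    (h : IsPathFrom src tgt u w p) : IsPathFrom tgt src w u p.reverse := by
  obtain ⟨h₀, hc, hh, hl⟩ := h
  refine ⟨by simpa using h₀, ?_, by simpa using hl, by simpa using hh⟩
  exact List.isChain_reverse.2 (hc.imp fun _ _ h => h.symm)

/-- An out-tree is an in-tree of the opposite graph. -/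
theorem IsOutTree.isInTree_swap {V E : Type*} [Fintype V] {src tgt : E → V} {v : V}
    {T : Finset E} (h : IsOutTree src tgt v T) : IsInTree tgt src v T := by
  refine ⟨h.1, fun u hu => ?_⟩
  obtain ⟨p, hpT, hp⟩ := h.2 u hu
  exact ⟨p.reverse, fun e he => hpT e (List.mem_reverse.1 he), hp.reverse⟩

/-- The distance to the root is a potential that strictly decreases along the edges of an
in-tree. -/
theorem IsInTree.exists_potential {V E : Type*} [Fintype V] {src tgt : E → V} {v : V}
    {T : Finset E} (h : IsInTree src tgt v T) :
    ∃ d : V → ℕ, ∀ e ∈ T, d (tgt e) < d (src e) := by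
  classical
  let L : V → Set ℕ := fun u =>
    {n | ∃ p : List E, (∀ e ∈ p, e ∈ T) ∧ IsPathFrom src tgt u v p ∧ p.length = n}
  let d : V → ℕ := fun u => if u = v then 0 else sInf (L u)
  have key : ∀ u : V, u ≠ v → ∃ e ∈ T, src e = u ∧ d (tgt e) < d u := by
    intro u hu
    have hne : (L u).Nonempty := by
      obtain ⟨p, hpT, hp⟩ := h.2 u hu
      exact ⟨p.length, p, hpT, hp, rfl⟩
    obtain ⟨p, hpT, hp, hlen⟩ := Nat.sInf_mem hne
    obtain ⟨e, q, rfl⟩ := List.exists_cons_of_ne_nil hp.1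
    refine ⟨e, hpT e (by simp), by simpa using hp.2.2.1, ?_⟩
    have hdu : d u = q.length + 1 := by
      simp only [d, if_neg hu, ← hlen, List.length_cons]
    rw [hdu]
    by_cases hv : tgt e = v
    · simp [d, hv]
    · have hq : q ≠ [] := by
        rintro rfl
        exact hv (by simpa using hp.2.2.2)
      have hle : sInf (L (tgt e)) ≤ q.length :=
        Nat.sInf_le ⟨q, fun f hf => hpT f (by simp [hf]), hp.tail hq, rfl⟩
      simp only [d, if_neg hv]
      omega
  choose g hgT hgs hgd using fun u : {u // u ≠ v} => key u u.2
  have hg : Function.Injective g := fun a b hab =>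
    Subtype.ext (by rw [← hgs a, hab, hgs b])
  have himage : Finset.univ.image g = T := by
    apply Finset.eq_of_subset_of_card_le
    · intro e he
      obtain ⟨u, -, rfl⟩ := Finset.mem_image.1 he
      exact hgT u
    · rw [Finset.card_image_of_injective _ hg, h.1, Finset.card_univ]
      exact (Set.card_ne_eq v).ge
  refine ⟨d, fun e he => ?_⟩
  rw [← himage] at he
  obtain ⟨u, -, rfl⟩ := Finset.mem_image.1 he
  rw [hgs u]
  exact hgd u

theorem deadlockFree_of_lt {V E α : Type*} [Preorder α]
    {route : ∀ u w : V, u ≠ w → List E} (f : E → α)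
    (hf : ∀ e₁ e₂, Dep route e₁ e₂ → f e₁ < f e₂) : DeadlockFree route := by
  have key : ∀ a b, Relation.TransGen (Dep route) a b → f a < f b := by
    intro a b hab
    induction hab with
    | single h => exact hf _ _ h
    | tail _ h ih => exact ih.trans (hf _ _ h)
  exact fun a ha => lt_irrefl _ (key a a ha)

/-- A routing scheme all of whose paths consist of edges of an in-tree followed by edges of an
edge-disjoint out-tree is deadlock-free. -/
theorem deadlockFree_of_inTree_outTree {V E : Type*} [Fintype V] {src tgt : E → V} {v : V}
    {Tin Tout : Finset E} (hin : IsInTree src tgt v Tin) (hout : IsOutTree src tgt v Tout)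
    (hdisj : Disjoint Tin Tout) {route : ∀ u w : V, u ≠ w → List E}
    (hroute : IsRouting src tgt route)
    (hsplit : ∀ (u w : V) (h : u ≠ w), ∃ p q : List E,
      (∀ e ∈ p, e ∈ Tin) ∧ (∀ e ∈ q, e ∈ Tout) ∧ route u w h = p ++ q) :
    DeadlockFree route := by
  classical
  obtain ⟨d, hd⟩ := hin.exists_potential
  obtain ⟨k, hk⟩ := hout.isInTree_swap.exists_potential
  refine deadlockFree_of_lt
    (fun e => if e ∈ Tin then -(d (src e) : ℤ) else (k (src e) : ℤ)) ?_
  rintro a b ⟨u, w, h, hab⟩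
  have hcons : tgt a = src b := by
    have hc : List.IsChain (fun e₁ e₂ => tgt e₁ = src e₂) [a, b] := (hroute u w h).2.1.infix hab
    simpa using hc
  obtain ⟨p, q, hp, hq, hpq⟩ := hsplit u w h
  rw [hpq] at hab
  have hmem : ∀ e ∈ p ++ q, e ∈ Tin ∨ e ∈ Tout := fun e he =>
    (List.mem_append.1 he).imp (hp e) (hq e)
  have horder : a ∈ Tin ∨ b ∈ Tout := by
    have hpw : (p ++ q).Pairwise fun e₁ e₂ => e₁ ∈ Tin ∨ e₂ ∈ Tout :=
      List.pairwise_append.2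
        ⟨List.pairwise_of_forall_mem_list fun e he _ _ => Or.inl (hp e he),
          List.pairwise_of_forall_mem_list fun _ _ e he => Or.inr (hq e he),
          fun e he _ _ => Or.inl (hp e he)⟩
    simpa using hpw.sublist hab.sublist
  have ha := hmem a (hab.subset (by simp))
  have hb := hmem b (hab.subset (by simp))
  by_cases ha' : a ∈ Tin
  · have hda := hd a ha'
    by_cases hb' : b ∈ Tin
    · simp only [if_pos ha', if_pos hb', ← hcons]
      omega
    · simp only [if_pos ha', if_neg hb']
      omega
  · have hbT := horder.resolve_left ha'
    have hka := hk a (ha.resolve_left ha')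
    have hb' : b ∉ Tin := fun hb' => Finset.disjoint_left.1 hdisj hb' hbT
    simp only [if_neg ha', if_neg hb', ← hcons]
    omega

/-- If a network contains a spanning in-tree and a spanning out-tree rooted at a common
vertex `v` that are edge-disjoint, then it admits a deadlock-free routing scheme; in
particular, any routing scheme that routes each message from `u` to `w` along the
`T_in`-path from `u` to `v` followed by the `T_out`-path from `v` to `w` (omitting the
corresponding half when `u = v` or `w = v`) is deadlock-free. -/
theorem two_trees_give_deadlockFree_routing
    {V E : Type*} [Fintype V] [Nonempty V] [Fintype E] (src tgt : E → V)
    (hloop : ∀ e : E, src e ≠ tgt e) (hconn : StronglyConnected src tgt)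
    (v : V) (Tin Tout : Finset E)
    (hin : IsInTree src tgt v Tin) (hout : IsOutTree src tgt v Tout)
    (hdisj : Disjoint Tin Tout) :
    (∃ route : ∀ u w : V, u ≠ w → List E, IsRouting src tgt route ∧ DeadlockFree route) ∧
    (∀ route : ∀ u w : V, u ≠ w → List E, IsRouting src tgt route →
      (∀ (u w : V) (h : u ≠ w), ∃ p q : List E,
        (∀ e ∈ p, e ∈ Tin) ∧ (∀ e ∈ q, e ∈ Tout) ∧ route u w h = p ++ q ∧
        (u = v → p = []) ∧ (u ≠ v → IsPathFrom src tgt u v p) ∧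
        (w = v → q = []) ∧ (w ≠ v → IsPathFrom src tgt v w q)) →
      DeadlockFree route) := by
  have hdeadlock : ∀ route : ∀ u w : V, u ≠ w → List E, IsRouting src tgt route →
      (∀ (u w : V) (h : u ≠ w), ∃ p q : List E,
        (∀ e ∈ p, e ∈ Tin) ∧ (∀ e ∈ q, e ∈ Tout) ∧ route u w h = p ++ q) →
      DeadlockFree route := fun _ =>
    deadlockFree_of_inTree_outTree hin hout hdisj
  refine ⟨?_, fun route hroute hsplit => hdeadlock route hroute fun u w h => ?_⟩
  · classical
    choose! P hPT hP using hin.2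
    choose! Q hQT hQ using hout.2
    let route : ∀ u w : V, u ≠ w → List E := fun u w _ =>
      (if u = v then [] else P u) ++ (if w = v then [] else Q w)
    suffices hroute : IsRouting src tgt route by
      refine ⟨route, hroute, hdeadlock route hroute fun u w _ => ⟨_, _, ?_, ?_, rfl⟩⟩
      · split_ifs with hu
        · simp
        · exact hPT u hu
      · split_ifs with hw
        · simp
        · exact hQT w hw
    intro u w h
    by_cases hu : u = v
    · subst hu
      simpa [route, h.symm] using hQ w h.symm
    · by_cases hw : w = v
      · subst hw
        simpa [route, h] using hP u h
      · simpa [route, hu, hw] using (hP u hu).append (hQ w hw)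
  · obtain ⟨p, q, hp, hq, hpq, -⟩ := hsplit u w h
    exact ⟨p, q, hp, hq, hpq⟩
end

section
/- Let G be a network (a finite, strongly connected directed multigraph without self-loops) with a deadlock-free routing scheme, and let ≤ be a linear order on the edge set E that respects the routing scheme. Let s be the attraction number of ≤ and G_s its attraction subgraph. If G_s has exactly one global attractor v, then there exist a spanning in-tree of G rooted at v and a spanning out-tree of G rooted at v whose edge sets are disjoint. -/
/-- `u` and `w` are joined by an edge of `A` directed from `u` to `w`. -/
def EdgeStep {V E : Type*} (src tgt : E → V) (A : Set E) (u w : V) : Prop :=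
  ∃ e ∈ A, src e = u ∧ tgt e = w

theorem EdgeStep.swap {V E : Type*} {src tgt : E → V} {A : Set E} :
    Function.swap (EdgeStep src tgt A) = EdgeStep tgt src A := by
  funext u w
  simp only [Function.swap, EdgeStep, and_comm]

theorem EdgeStep.mono {V E : Type*} {src tgt : E → V} {A B : Set E} (h : A ⊆ B) {u w : V}
    (huw : EdgeStep src tgt A u w) : EdgeStep src tgt B u w := by
  obtain ⟨e, he, hs, ht⟩ := huw
  exact ⟨e, h he, hs, ht⟩

theorem IsPathFrom.transGen {V E : Type*} {src tgt : E → V} {A : Set E} {w : V} {p : List E}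
    (hA : ∀ e ∈ p, e ∈ A) {u : V} (hp : IsPathFrom src tgt u w p) :
    Relation.TransGen (EdgeStep src tgt A) u w := by
  induction p generalizing u with
  | nil => exact absurd rfl hp.1
  | cons e p ih =>
    obtain ⟨-, hc, hh, hl⟩ := hp
    have hs : src e = u := by simpa using hh
    cases p with
    | nil => exact .single ⟨e, hA e (by simp), hs, by simpa using hl⟩
    | cons f p =>
      have hc' := List.isChain_cons_cons.1 hc
      refine .head ⟨e, hA e (by simp), hs, rfl⟩
        (ih (fun x hx => hA x (List.mem_cons_of_mem _ hx)) ⟨by simp, hc'.2, ?_, ?_⟩)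
      · simp [hc'.1]
      · simpa using hl

theorem reachableVia_iff_transGen {V E : Type*} {src tgt : E → V} {A : Set E} {u w : V} :
    ReachableVia src tgt A u w ↔ Relation.TransGen (EdgeStep src tgt A) u w := by
  refine ⟨fun ⟨p, hA, hp⟩ => hp.transGen hA, fun h => ?_⟩
  induction h using Relation.TransGen.head_induction_on with
  | single h =>
    obtain ⟨e, he, rfl, rfl⟩ := h
    exact ⟨[e], by simpa using he, by simp, List.isChain_singleton _, rfl, rfl⟩
  | head h _ ih =>
    obtain ⟨e, he, rfl, rfl⟩ := h
    obtain ⟨p, hA, hne, hc, hh, hl⟩ := ih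
    cases p with
    | nil => exact absurd rfl hne
    | cons f p =>
      have hf : src f = tgt e := by simpa using hh
      refine ⟨e :: f :: p, ?_, by simp, List.isChain_cons_cons.2 ⟨hf.symm, hc⟩, rfl, ?_⟩
      · rintro x (_ | ⟨_, hx⟩)
        exacts [he, hA x hx]
      · simpa using hl

theorem reachableVia_swap {V E : Type*} {src tgt : E → V} {A : Set E} {u w : V} :
    ReachableVia tgt src A w u ↔ ReachableVia src tgt A u w := by
  rw [reachableVia_iff_transGen, reachableVia_iff_transGen, ← EdgeStep.swap,
    Relation.transGen_swap]

/-- A directed path entering a set of vertices uses an edge that crosses into it. -/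
theorem exists_crossing_edge {V E : Type*} {src tgt : E → V} {A : Set E} {S : Finset V} {u v : V}
    (h : Relation.TransGen (EdgeStep src tgt A) u v) (hu : u ∉ S) (hv : v ∈ S) :
    ∃ e ∈ A, src e ∉ S ∧ tgt e ∈ S := by
  induction h using Relation.TransGen.head_induction_on with
  | single h =>
    obtain ⟨e, he, rfl, rfl⟩ := h
    exact ⟨e, he, hu, hv⟩
  | @head a c h _ ih =>
    by_cases hc : c ∈ S
    · obtain ⟨e, he, rfl, rfl⟩ := h
      exact ⟨e, he, hu, hc⟩
    · exact ih hc

theorem exists_partial_inTree {V E : Type*} [Fintype V] {src tgt : E → V} {A : Set E} {v : V}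
    (h : IsGlobalAttractor src tgt A v) (n : ℕ) (hn : n + 1 ≤ Fintype.card V) :
    ∃ (S : Finset V) (T : Finset E), S.card = n + 1 ∧ T.card = n ∧ v ∈ S ∧ ↑T ⊆ A ∧
      (∀ e ∈ T, src e ∈ S) ∧
      ∀ u ∈ S, u ≠ v → Relation.TransGen (EdgeStep src tgt ↑T) u v := by
  classical
  induction n with
  | zero => exact ⟨{v}, ∅, by simp⟩
  | succ n ih =>
    obtain ⟨S, T, hS, hT, hvS, hTA, hsrc, hreach⟩ := ih (by omega)
    obtain ⟨u, hu⟩ : ∃ u, u ∉ S := by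
      by_contra! hall
      rw [Finset.eq_univ_iff_forall.2 hall, Finset.card_univ] at hS
      omega
    obtain ⟨e, heA, hes, het⟩ := exists_crossing_edge
      (reachableVia_iff_transGen.1 (h u (by rintro rfl; exact hu hvS))) hu hvS
    have heT : e ∉ T := fun he => hes (hsrc e he)
    have hmono : ∀ a b, EdgeStep src tgt ↑T a b → EdgeStep src tgt ↑(insert e T) a b :=
      fun _ _ => EdgeStep.mono (by simp)
    have hstep : EdgeStep src tgt ↑(insert e T) (src e) (tgt e) := ⟨e, by simp, rfl, rfl⟩
    refine ⟨insert (src e) S, insert e T, by simp [hes, hS], by simp [heT, hT], by simp [hvS],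
      ?_, ?_, ?_⟩
    · simpa [Set.insert_subset_iff] using ⟨heA, hTA⟩
    · intro x hx
      rcases Finset.mem_insert.1 hx with rfl | hx
      · simp
      · exact Finset.mem_insert_of_mem (hsrc x hx)
    · intro x hx hxv
      rcases Finset.mem_insert.1 hx with rfl | hx
      · by_cases htv : tgt e = v
        · exact .single (htv ▸ hstep)
        · exact .head hstep (Relation.TransGen.mono hmono _ _ (hreach _ het htv))
      · exact Relation.TransGen.mono hmono _ _ (hreach x hx hxv)

theorem IsGlobalAttractor.exists_inTree {V E : Type*} [Fintype V] {src tgt : E → V} {A : Set E}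
    {v : V} (h : IsGlobalAttractor src tgt A v) :
    ∃ T : Finset E, ↑T ⊆ A ∧ IsInTree src tgt v T := by
  have hpos : 0 < Fintype.card V := Fintype.card_pos_iff.2 ⟨v⟩
  obtain ⟨S, T, hS, hT, -, hTA, -, hreach⟩ :=
    exists_partial_inTree h (Fintype.card V - 1) (by omega)
  have hu : S = Finset.univ := Finset.card_eq_iff_eq_univ S |>.1 (by omega)
  exact ⟨T, hTA, hT, fun u huv => reachableVia_iff_transGen.2 (hreach u (by simp [hu]) huv)⟩

theorem exists_outTree {V E : Type*} [Fintype V] {src tgt : E → V} {A : Set E} {v : V}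
    (h : ∀ w : V, w ≠ v → ReachableVia src tgt A v w) :
    ∃ T : Finset E, ↑T ⊆ A ∧ IsOutTree src tgt v T := by
  have hatt : IsGlobalAttractor tgt src A v := fun w hw => reachableVia_swap.2 (h w hw)
  obtain ⟨T, hTA, hcard, hreach⟩ := hatt.exists_inTree
  exact ⟨T, hTA, hcard, fun w hw => reachableVia_swap.1 (hreach w hw)⟩

/-- The head of an edge leaving a global attractor is a global attractor. -/
theorem IsGlobalAttractor.tgt {V E : Type*} {src tgt : E → V} {A : Set E} {e : E}
    (h : IsGlobalAttractor src tgt A (src e)) (he : e ∈ A) :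
    IsGlobalAttractor src tgt A (tgt e) := by
  intro u _
  have hstep : EdgeStep src tgt A (src e) (tgt e) := ⟨e, he, rfl, rfl⟩
  rw [reachableVia_iff_transGen]
  by_cases hu : u = src e
  · exact hu ▸ .single hstep
  · exact (reachableVia_iff_transGen.1 (h u hu)).tail hstep

theorem mem_smallestEdges_of_le {E : Type*} [Finite E] {ord : LinearOrder E} {s : ℕ} {e f : E}
    (hef : ord.le e f) (hf : f ∈ smallestEdges ord s) : e ∈ smallestEdges ord s :=
  (Set.ncard_le_ncard (fun x hx => ord.le_trans x e f hx hef) (Set.toFinite _)).trans hf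

theorem RespectsRouting.isChain_lt {V E : Type*} {route : ∀ u w : V, u ≠ w → List E}
    {ord : LinearOrder E} (hresp : RespectsRouting route ord) {u w : V} (h : u ≠ w) :
    (route u w h).IsChain ord.lt :=
  List.isChain_iff_forall_rel_of_append_cons_cons.2 fun {a b l₁ l₂} hl =>
    hresp a b ⟨u, w, h, l₁, l₂, by simp [hl]⟩

/-- A routing path whose first edge is not among the `s` smallest avoids these edges. -/
theorem RespectsRouting.notMem_smallestEdges {V E : Type*} [Finite E] {src tgt : E → V}
    {route : ∀ u w : V, u ≠ w → List E} {ord : LinearOrder E}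
    (hroute : IsRouting src tgt route) (hresp : RespectsRouting route ord) {s : ℕ} {u w : V}
    (hout : ∀ e, src e = u → e ∉ smallestEdges ord s) (h : u ≠ w) {e : E}
    (he : e ∈ route u w h) : e ∉ smallestEdges ord s := by
  have hchain := hresp.isChain_lt h
  obtain ⟨hne, -, hh, -⟩ := hroute u w h
  generalize route u w h = p at *
  cases p with
  | nil => exact absurd rfl hne
  | cons f p =>
    have hf := hout f (by simpa using hh)
    rcases List.mem_cons.1 he with rfl | he
    · exact hf
    · let := ord
      exact fun hmem => hf (mem_smallestEdges_of_le (le_of_lt (hchain.rel_cons he)) hmem)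

/-- Lemma (single attractor): if the attraction subgraph of a routing-respecting linear
order has exactly one global attractor `v`, then the network contains edge-disjoint
spanning in- and out-trees rooted at `v`. -/
theorem single_attractor_gives_two_trees
    {V E : Type*} [Fintype V] [Nonempty V] [Fintype E] (src tgt : E → V)
    (hloop : ∀ e : E, src e ≠ tgt e) (hconn : StronglyConnected src tgt)
    (route : ∀ u w : V, u ≠ w → List E)
    (hroute : IsRouting src tgt route) (hdf : DeadlockFree route)
    (ord : LinearOrder E) (hresp : RespectsRouting route ord)
    (v : V)
    (hv : IsGlobalAttractor src tgt (smallestEdges ord (attractionNumber src tgt ord)) v)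
    (huniq : ∀ v' : V,
      IsGlobalAttractor src tgt (smallestEdges ord (attractionNumber src tgt ord)) v' →
      v' = v) :
    ∃ Tin Tout : Finset E, IsInTree src tgt v Tin ∧ IsOutTree src tgt v Tout ∧
      Disjoint Tin Tout := by
  have hout : ∀ e, src e = v →
      e ∉ smallestEdges ord (attractionNumber src tgt ord) := by
    rintro e rfl he
    exact hloop e (huniq _ (hv.tgt he)).symm
  obtain ⟨Tin, hTin, hin⟩ := hv.exists_inTree
  obtain ⟨Tout, hTout, hout⟩ := exists_outTree
    (A := (smallestEdges ord (attractionNumber src tgt ord))ᶜ)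
    fun w hw => ⟨route v w hw.symm,
      fun _ he => hresp.notMem_smallestEdges hroute hout hw.symm he, hroute v w hw.symm⟩
  exact ⟨Tin, Tout, hin, hout,
    Finset.disjoint_left.2 fun _ he he' => hTout he' (hTin he)⟩
end
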